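/- Let D_0 be the set of linear endomorphisms A of the 24-dimensional 2-step nilpotent Lie algebra n_{E_II} = n_{−2} ⊕ n_{−1} satisfying A(n_{−1}) ⊆ n_{−1}, A(n_{−2}) ⊆ n_{−2}, and A[v,w] = [Av,w] + [v,Aw] for all v,w ∈ n_{E_II} (strata-preserving derivations). Then D_0 is a Lie subalgebra of gl(n_{E_II}) (under the commutator bracket) of real dimension 30. -/

import Mathlib

noncomputable section
open ComplexConjugate

/-- Points of `ℝ²⁴`, with coordinates `u^i = p (i-1)`, `x^i = p (7+i)`, `y^i = p (15+i)`
for `i = 1, …, 8`. -/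
abbrev Pt : Type := Fin 24 → ℝ
/-- The bracket of the 24-dimensional 2-step nilpotent Lie algebra `n_{E_II}`, in the
basis `X_1, …, X_24` (indexed here by `0, …, 23`): for each term `ε·λ^B∧λ^D` in the E_II
structure equations one has `[X_B, X_D] = -ε·X_A`, and `X_1, …, X_8` are central. -/
def br (v w : Pt) : Pt := fun k =>
  if h : (k : ℕ) < 8 then
    (![-((v 8 * w 19 - v 19 * w 8) + (v 9 * w 18 - v 18 * w 9)
        + (v 10 * w 17 - v 17 * w 10) + (v 11 * w 16 - v 16 * w 11)),
       -((v 8 * w 21 - v 21 * w 8) + (v 9 * w 20 - v 20 * w 9)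
        + (v 12 * w 17 - v 17 * w 12) + (v 13 * w 16 - v 16 * w 13)),
       -((v 8 * w 14 - v 14 * w 8) - (v 10 * w 12 - v 12 * w 10)
        + (v 16 * w 22 - v 22 * w 16) - (v 18 * w 20 - v 20 * w 18)),
       -((v 8 * w 15 - v 15 * w 8) + (v 9 * w 14 - v 14 * w 9)
        + (v 10 * w 13 - v 13 * w 10) + (v 11 * w 12 - v 12 * w 11)
        + (v 16 * w 23 - v 23 * w 16) + (v 17 * w 22 - v 22 * w 17)
        + (v 18 * w 21 - v 21 * w 18) + (v 19 * w 20 - v 20 * w 19)),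
       -(-(v 8 * w 23 - v 23 * w 8) + (v 9 * w 22 - v 22 * w 9)
        + (v 10 * w 21 - v 21 * w 10) - (v 11 * w 20 - v 20 * w 11)
        - (v 12 * w 19 - v 19 * w 12) + (v 13 * w 18 - v 18 * w 13)
        + (v 14 * w 17 - v 17 * w 14) - (v 15 * w 16 - v 16 * w 15)),
       -((v 9 * w 15 - v 15 * w 9) - (v 11 * w 13 - v 13 * w 11)
        + (v 17 * w 23 - v 23 * w 17) - (v 19 * w 21 - v 21 * w 19)),
       -((v 10 * w 23 - v 23 * w 10) + (v 11 * w 22 - v 22 * w 11)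
        + (v 14 * w 19 - v 19 * w 14) + (v 15 * w 18 - v 18 * w 15)),
       -((v 12 * w 23 - v 23 * w 12) + (v 13 * w 22 - v 22 * w 13)
        + (v 14 * w 21 - v 21 * w 14) + (v 15 * w 20 - v 20 * w 15))] : Fin 8 → ℝ) ⟨k, h⟩
  else 0
/-- The stratum `n_{-2} = span (X_1, …, X_8)`. -/
def Nm2 : Submodule ℝ Pt where
  carrier := {v | ∀ k : Fin 24, 8 ≤ (k : ℕ) → v k = 0}
  add_mem' := by
    intro a b ha hb
    simp only [Set.mem_setOf_eq] at ha hb ⊢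
    intro k hk
    simp [Pi.add_apply, ha k hk, hb k hk]
  zero_mem' := by intro k _; rfl
  smul_mem' := by
    intro c v hv
    simp only [Set.mem_setOf_eq] at hv ⊢
    intro k hk
    simp [Pi.smul_apply, hv k hk]

/-- The stratum `n_{-1} = span (X_9, …, X_24)`. -/
def Nm1 : Submodule ℝ Pt where
  carrier := {v | ∀ k : Fin 24, (k : ℕ) < 8 → v k = 0}
  add_mem' := by
    intro a b ha hb
    simp only [Set.mem_setOf_eq] at ha hb ⊢
    intro k hk
    simp [Pi.add_apply, ha k hk, hb k hk]
  zero_mem' := by intro k _; rfl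
  smul_mem' := by
    intro c v hv
    simp only [Set.mem_setOf_eq] at hv ⊢
    intro k hk
    simp [Pi.smul_apply, hv k hk]
/-- A strata-preserving derivation: a linear endomorphism `A` with `A (n_{-1}) ⊆ n_{-1}`,
`A (n_{-2}) ⊆ n_{-2}`, and `A [v, w] = [A v, w] + [v, A w]`. -/
def IsSPDer (A : Module.End ℝ Pt) : Prop :=
  (∀ v ∈ Nm1, A v ∈ Nm1) ∧ (∀ v ∈ Nm2, A v ∈ Nm2) ∧
    ∀ v w : Pt, A (br v w) = br (A v) w + br v (A w)

/-- A linear form in the entries of a `24 × 24` matrix, stored as a list of pairs `(c, n)`,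
where `n = 24 * r + s` is the position of the entry `(r, s)`. -/
abbrev LinForm : Type := List (ℤ × ℕ)

namespace LinForm

/-- The value of a linear form. -/
def eval (a : ℕ → ℝ) (L : LinForm) : ℝ :=
  (L.map fun t => (t.1 : ℝ) * a t.2).sum

variable {a : ℕ → ℝ}

@[simp] lemma eval_nil : eval a [] = 0 := rfl

@[simp] lemma eval_cons (t : ℤ × ℕ) (L : LinForm) :
    eval a (t :: L) = t.1 * a t.2 + eval a L := by
  simp [eval]

@[simp] lemma eval_append (L L' : LinForm) : eval a (L ++ L') = eval a L + eval a L' := by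
  simp [eval]

lemma eval_flatMap {α : Type*} (l : List α) (f : α → LinForm) :
    eval a (l.flatMap f) = (l.map fun x => eval a (f x)).sum := by
  induction l with
  | nil => rfl
  | cons x l ih => simp [ih]

lemma eval_filter (q : ℤ × ℕ → Bool) (L : LinForm)
    (hq : ∀ t ∈ L, q t = false → a t.2 = 0) : eval a (L.filter q) = eval a L := by
  induction L with
  | nil => rfl
  | cons t L ih =>
    have ih := ih fun t ht => hq t (List.mem_cons_of_mem _ ht)
    cases h : q t with
    | true => simp [h, ih]
    | false => simp [h, ih, hq t List.mem_cons_self h]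

end LinForm

/-- Every entry of `a` flagged by the bit mask `m` vanishes. -/
def VanishesOn (a : ℕ → ℝ) (m : ℕ) : Prop :=
  ∀ n, m.testBit n = true → a n = 0

/-- If all but one of the entries occurring in the form `L` are flagged by `m`, flag the
remaining one as well. -/
def propagate (m : ℕ) (L : LinForm) : ℕ :=
  match L.filter fun t => !m.testBit t.2 with
  | [(c, n)] => if c = 0 then m else m ||| 2 ^ n
  | _ => m

lemma VanishesOn.propagate {a : ℕ → ℝ} {m : ℕ} (h : VanishesOn a m)
    {L : LinForm} (hL : L.eval a = 0) : VanishesOn a (propagate m L) := by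
  unfold _root_.propagate
  split
  · next c n hf =>
    split
    · exact h
    · next hc =>
      have he := LinForm.eval_filter (a := a) (fun t => !m.testBit t.2) L
        (fun t _ ht => h _ (by simpa using ht))
      rw [hf, hL] at he
      have hz : a n = 0 := by simpa [hc] using he
      intro n' hb
      rw [Nat.testBit_or, Bool.or_eq_true, Nat.testBit_two_pow, decide_eq_true_eq] at hb
      rcases hb with hb | rfl
      · exact h _ hb
      · exact hz
  · exact h

/-- The left fold of `propagate`. Both branches of the test agree; it makes the kernel
evaluate the mask at every step. -/
def propagateAll : List LinForm → ℕ → ℕ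
  | [], m => m
  | L :: Ls, m =>
    if propagate m L = 0 then propagateAll Ls 0 else propagateAll Ls (propagate m L)

lemma VanishesOn.propagateAll {a : ℕ → ℝ} (Ls : List LinForm)
    (hLs : ∀ L ∈ Ls, L.eval a = 0) {m : ℕ} (h : VanishesOn a m) :
    VanishesOn a (propagateAll Ls m) := by
  induction Ls generalizing m with
  | nil => exact h
  | cons L Ls ih =>
    have ih := @ih fun L hL => hLs L (List.mem_cons_of_mem _ hL)
    have hL := h.propagate (hLs L List.mem_cons_self)
    unfold _root_.propagateAll
    split
    · next h0 => exact ih (h0 ▸ hL)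
    · exact ih hL

/-- The structure constants: `(c, b, d)` in `bracketTerms k` stands for the summand
`c * (v b * w d - v d * w b)` of the `k`-th component of `br v w`. -/
def bracketTerms : Fin 8 → List (ℤ × Fin 24 × Fin 24) :=
  ![
    [(-1, 8, 19), (-1, 9, 18), (-1, 10, 17), (-1, 11, 16)],
    [(-1, 8, 21), (-1, 9, 20), (-1, 12, 17), (-1, 13, 16)],
    [(-1, 8, 14), (1, 10, 12), (-1, 16, 22), (1, 18, 20)],
    [(-1, 8, 15), (-1, 9, 14), (-1, 10, 13), (-1, 11, 12),
     (-1, 16, 23), (-1, 17, 22), (-1, 18, 21), (-1, 19, 20)],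
    [(1, 8, 23), (-1, 9, 22), (-1, 10, 21), (1, 11, 20),
     (1, 12, 19), (-1, 13, 18), (-1, 14, 17), (1, 15, 16)],
    [(-1, 9, 15), (1, 11, 13), (-1, 17, 23), (1, 19, 21)],
    [(-1, 10, 23), (-1, 11, 22), (-1, 14, 19), (-1, 15, 18)],
    [(-1, 12, 23), (-1, 13, 22), (-1, 14, 21), (-1, 15, 20)]]

lemma br_apply_castLE (v w : Pt) (k : Fin 8) :
    br v w (k.castLE (by norm_num)) =
      ((bracketTerms k).map fun t =>
        (t.1 : ℝ) * (v t.2.1 * w t.2.2 - v t.2.2 * w t.2.1)).sum := by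
  fin_cases k <;> simp [br, bracketTerms] <;> ring

lemma br_apply_of_le (v w : Pt) {k : Fin 24} (hk : 8 ≤ (k : ℕ)) : br v w k = 0 := by
  simp [br, hk.not_gt]

/-- The bracket of the basis vectors `i` and `j`, as a list of pairs `(c, l)` standing for
`c` times the `l`-th basis vector. -/
def bracketBasis (i j : Fin 24) : List (ℤ × Fin 8) :=
  [0, 1, 2, 3, 4, 5, 6, 7].flatMap fun l => (bracketTerms l).flatMap fun t =>
    (bif t.2.1.val.beq i && t.2.2.val.beq j then [(t.1, l)] else []) ++
    (bif t.2.2.val.beq i && t.2.1.val.beq j then [(-t.1, l)] else [])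

/-- The `k`-th coordinate of the derivation identity at the basis vectors `i`, `j`, as a
linear form in the matrix entries. -/
def derivationForm (k : Fin 8) (i j : Fin 24) : LinForm :=
  ((bracketTerms k).flatMap fun t =>
    (bif t.2.2.val.beq j then [(t.1, 24 * t.2.1.val + i.val)] else []) ++
    (bif t.2.1.val.beq j then [(-t.1, 24 * t.2.2.val + i.val)] else []) ++
    (bif t.2.1.val.beq i then [(t.1, 24 * t.2.2.val + j.val)] else []) ++
    (bif t.2.2.val.beq i then [(-t.1, 24 * t.2.1.val + j.val)] else [])) ++
  (bracketBasis i j).map fun t => (-t.1, 24 * k.val + t.2.val)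

/-- The coordinates of the image of the `s`-th basis vector, `s < 24`; the one in position `r`
is `entry A (24 * r + s)`. -/
def entry (A : Module.End ℝ Pt) (n : ℕ) : ℝ :=
  A (Pi.single (Fin.ofNat 24 n) 1) (Fin.ofNat 24 (n / 24))

lemma entry_eq (A : Module.End ℝ Pt) (r s : Fin 24) :
    entry A (24 * r.val + s.val) = A (Pi.single s 1) r := by
  have hs : Fin.ofNat 24 (24 * r.val + s.val) = s := by
    ext
    simp [Nat.mod_eq_of_lt s.isLt]
  have hr : Fin.ofNat 24 ((24 * r.val + s.val) / 24) = r := by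
    ext
    simp only [Fin.ofNat]
    omega
  rw [entry, hs, hr]

lemma beq_val_eq_decide (x y : Fin 24) : (x.val.beq y.val) = decide (x = y) := by
  rw [Bool.eq_iff_iff]
  simp [Fin.ext_iff]

lemma sum_map_flatMap {α β M : Type*} [AddMonoid M] (l : List α) (f : α → List β)
    (g : β → M) :
    ((l.flatMap f).map g).sum = (l.map fun x => ((f x).map g).sum).sum := by
  induction l with
  | nil => rfl
  | cons x l ih => simp [ih]

lemma br_eq_sum (v w : Pt) :
    br v w = ∑ l : Fin 8, br v w (l.castLE (by norm_num)) •
      (Pi.single (l.castLE (by norm_num)) 1 : Pt) := by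
  ext k
  rw [Finset.sum_apply]
  simp only [Pi.smul_apply, smul_eq_mul, Pi.single_apply, mul_ite, mul_one, mul_zero]
  by_cases hk : (k : ℕ) < 8
  · rw [Finset.sum_eq_single ⟨k, hk⟩]
    · simp
    · intro l _ hl
      refine if_neg fun h => hl ?_
      ext
      simp [h]
    · simp
  · rw [br_apply_of_le v w (not_lt.mp hk), Finset.sum_eq_zero]
    intro l _
    refine if_neg fun h => hk ?_
    simp [h]

lemma br_single_single (i j : Fin 24) :
    br (Pi.single i 1) (Pi.single j 1) =
      ((bracketBasis i j).map fun t =>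
        (t.1 : ℝ) • (Pi.single (t.2.castLE (by norm_num)) 1 : Pt)).sum := by
  have hfin : List.finRange 8 = [0, 1, 2, 3, 4, 5, 6, 7] := rfl
  rw [br_eq_sum, Fin.sum_univ_def, bracketBasis, ← hfin, sum_map_flatMap]
  congr 1
  refine List.map_congr_left fun l _ => ?_
  rw [br_apply_castLE, List.sum_smul, sum_map_flatMap, List.map_map]
  congr 1
  refine List.map_congr_left fun t _ => ?_
  simp only [beq_val_eq_decide, Function.comp_apply, Pi.single_apply, ← Bool.decide_and,
    Bool.cond_decide, ite_zero_mul_ite_zero, mul_one]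
  split_ifs <;> simp

lemma IsSPDer.eval_derivationForm {A : Module.End ℝ Pt} (hA : IsSPDer A) (k : Fin 8)
    (i j : Fin 24) : (derivationForm k i j).eval (entry A) = 0 := by
  have h := congrFun (hA.2.2 (Pi.single i 1) (Pi.single j 1)) (k.castLE (by norm_num))
  rw [Pi.add_apply, br_apply_castLE, br_apply_castLE, ← List.sum_map_add, br_single_single] at h
  change (LinearMap.proj (k.castLE (by norm_num)) ∘ₗ A) _ = _ at h
  rw [map_list_sum, List.map_map] at h
  rw [derivationForm, LinForm.eval_append, LinForm.eval_flatMap]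
  have h' : LinForm.eval (entry A)
      ((bracketBasis i j).map fun t => (-t.1, 24 * k.val + t.2.val)) =
      -((bracketBasis i j).map ((LinearMap.proj (k.castLE (by norm_num)) ∘ₗ A) ∘ fun t =>
        (t.1 : ℝ) • (Pi.single (t.2.castLE (by norm_num)) 1 : Pt))).sum := by
    rw [LinForm.eval, List.map_map, List.sum_neg, List.map_map]
    congr 1
    refine List.map_congr_left fun t _ => ?_
    have := entry_eq A (k.castLE (by norm_num)) (t.2.castLE (by norm_num))
    simp only [Fin.val_castLE] at this
    simp [this]
  rw [h', h, ← sub_eq_add_neg, sub_eq_zero]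
  congr 1
  refine List.map_congr_left fun t _ => ?_
  simp only [beq_val_eq_decide, Bool.cond_decide, LinForm.eval_append, Pi.single_apply]
  split_ifs <;> simp [entry_eq] <;> ring

lemma IsSPDer.entry_sixteen {A : Module.End ℝ Pt} (hA : IsSPDer A) :
    entry A (24 * 16 + 16) = entry A (24 * 8 + 8) := by
  have h₁ := hA.eval_derivationForm 3 8 15
  have h₂ := hA.eval_derivationForm 3 16 23
  have h₃ := hA.eval_derivationForm 4 8 23
  have h₄ := hA.eval_derivationForm 4 15 16
  have e₁ : derivationForm 3 8 15 = [(-1, 200), (-1, 375), (1, 75)] := by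
    decide +kernel
  have e₂ : derivationForm 3 16 23 = [(-1, 400), (-1, 575), (1, 75)] := by
    decide +kernel
  have e₃ : derivationForm 4 8 23 = [(1, 200), (1, 575), (-1, 100)] := by
    decide +kernel
  have e₄ : derivationForm 4 15 16 = [(1, 375), (1, 400), (-1, 100)] := by
    decide +kernel
  simp [e₁, e₂, e₃, e₄] at h₁ h₂ h₃ h₄ ⊢
  linarith

/-- Thirty matrix positions whose entries determine a strata-preserving derivation. -/
def coordinate : Fin 30 → Fin 24 × Fin 24 :=
  ![(0, 1), (0, 2), (0, 3), (0, 4), (0, 5), (0, 6), (1, 0), (1, 2), (1, 3), (1, 4),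
    (1, 5), (2, 0), (2, 1), (2, 3), (2, 4), (5, 0), (5, 1), (5, 3), (5, 4), (6, 0),
    (6, 3), (6, 4), (7, 3), (7, 4), (8, 16), (9, 17), (0, 0), (1, 1), (3, 3), (8, 8)]

/-- Linear forms vanishing on the matrix of a strata-preserving derivation whose entries at
the positions `coordinate n` are zero. -/
def linearSystem : List LinForm :=
  (List.ofFn fun n => [(1, 24 * (coordinate n).1.val + (coordinate n).2.val)]) ++
  [(1, 24 * 16 + 16), (-1, 24 * 8 + 8)] ::
  [8, 9, 10, 11, 12, 13, 14, 15, 16, 17, 18, 19, 20, 21, 22, 23].flatMap fun i : Fin 24 =>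
    [8, 9, 10, 11, 12, 13, 14, 15, 16, 17, 18, 19, 20, 21, 22, 23].flatMap fun j : Fin 24 =>
      bif Nat.blt i j then [0, 1, 2, 3, 4, 5, 6, 7].map fun k : Fin 8 => derivationForm k i j
      else []

/-- The bit mask of the two diagonal blocks of a `24 × 24` matrix. -/
def blockMask : ℕ :=
  ∑ r ∈ Finset.range 8, 2 ^ (24 * r) * (2 ^ 8 - 1) +
  ∑ r ∈ Finset.Ico 8 24, 2 ^ (24 * r) * (2 ^ 24 - 2 ^ 8)

lemma propagateAll_linearSystem :
    propagateAll (linearSystem ++ linearSystem) 0 = blockMask := by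
  decide +kernel

lemma testBit_blockMask {r s : Fin 24} (hrs : (r : ℕ) < 8 ↔ (s : ℕ) < 8) :
    blockMask.testBit (24 * r.val + s.val) = true := by
  revert r s
  decide +kernel

lemma IsSPDer.eq_zero {A : Module.End ℝ Pt} (hA : IsSPDer A)
    (h : ∀ n, A (Pi.single (coordinate n).2 1) (coordinate n).1 = 0) : A = 0 := by
  have hsys : ∀ L ∈ linearSystem, L.eval (entry A) = 0 := by
    intro L hL
    simp only [linearSystem, List.mem_append, List.mem_ofFn, List.mem_cons,
      List.mem_flatMap, Bool.cond_eq_ite] at hL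
    rcases hL with ⟨n, rfl⟩ | rfl | ⟨i, -, j, -, hL⟩
    · simp [entry_eq, h]
    · simp [hA.entry_sixteen]
    · split at hL
      · obtain ⟨k, -, rfl⟩ := List.mem_map.mp hL
        exact hA.eval_derivationForm k i j
      · simp at hL
  have hv : VanishesOn (entry A) blockMask := by
    rw [← propagateAll_linearSystem]
    refine VanishesOn.propagateAll _ (fun L hL => ?_) (fun n hn => by simp at hn)
    exact hsys L (by simpa using hL)
  ext s r
  by_cases hrs : (r : ℕ) < 8 ↔ (s : ℕ) < 8
  · simpa [entry_eq] using hv _ (testBit_blockMask hrs)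
  · by_cases hs : (s : ℕ) < 8
    · refine hA.2.1 _ (fun k hk => Pi.single_eq_of_ne ?_ _) r (by omega)
      rintro rfl
      omega
    · refine hA.1 _ (fun k hk => Pi.single_eq_of_ne ?_ _) r (by omega)
      rintro rfl
      omega

/-- The strata-preserving derivation with prescribed entries at the positions `coordinate n`. -/
def derivationOf (p : Fin 30 → ℝ) : Module.End ℝ Pt where
  toFun v := ![
      p 26 * v 0 + p 0 * v 1 + p 1 * v 2 + p 2 * v 3 + p 3 * v 4 + p 4 * v 5 + p 5 * v 6,
      p 6 * v 0 + p 27 * v 1 + p 7 * v 2 + p 8 * v 3 + p 9 * v 4 + p 10 * v 5 + p 5 * v 7,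
      p 11 * v 0 + p 12 * v 1 + (-p 26 - p 27 + 2 * p 28 + 2 * p 29) * v 2 + p 13 * v 3
       + p 14 * v 4 + p 10 * v 6 - p 4 * v 7,
      (2 * p 22) * v 0 + (-2 * p 20) * v 1 + (2 * p 17) * v 2 + p 28 * v 3 + (p 24 - p 25) * v 4
       + (2 * p 13) * v 5 + (-2 * p 8) * v 6 + (2 * p 2) * v 7,
      (2 * p 23) * v 0 + (-2 * p 21) * v 1 + (2 * p 18) * v 2 + (-p 24 + p 25) * v 3 + p 28 * v 4
       + (2 * p 14) * v 5 + (-2 * p 9) * v 6 + (2 * p 3) * v 7,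
      p 15 * v 0 + p 16 * v 1 + p 17 * v 3 + p 18 * v 4 + (p 26 + p 27 - 2 * p 29) * v 5
       + p 7 * v 6 - p 1 * v 7,
      p 19 * v 0 + p 16 * v 2 + p 20 * v 3 + p 21 * v 4 + p 12 * v 5 + (-p 27 + 2 * p 28) * v 6
       + p 0 * v 7,
      p 19 * v 1 - p 15 * v 2 + p 22 * v 3 + p 23 * v 4 - p 11 * v 5 + p 6 * v 6 + (-p 26
       + 2 * p 28) * v 7,
      p 29 * v 8 + p 13 * v 9 + p 9 * v 10 - p 3 * v 12 + p 5 * v 14 + p 24 * v 16 - p 14 * v 17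
       + p 8 * v 18 - p 10 * v 19 - p 2 * v 20 + p 4 * v 21,
      p 17 * v 8 + (p 26 + p 27 - p 28 - p 29) * v 9 - p 9 * v 11 + p 3 * v 13 + p 5 * v 15
       + p 18 * v 16 + p 25 * v 17 - p 7 * v 18 + p 8 * v 19 + p 1 * v 20 - p 2 * v 21,
      -p 21 * v 8 + (-p 27 + p 28 + p 29) * v 10 - p 13 * v 11 + p 0 * v 12 + p 3 * v 14
       + p 20 * v 16 + p 12 * v 17 + p 25 * v 18 - p 14 * v 19 - p 2 * v 22 - p 4 * v 23,
      p 21 * v 9 - p 17 * v 10 + (p 26 - p 29) * v 11 + p 0 * v 13 - p 3 * v 15 + p 16 * v 16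
       + p 20 * v 17 + p 18 * v 18 + p 24 * v 19 - p 1 * v 22 - p 2 * v 23,
      -p 23 * v 8 + p 6 * v 10 + (-p 26 + p 28 + p 29) * v 12 - p 13 * v 13 + p 9 * v 14
       + p 22 * v 16 - p 11 * v 17 + p 25 * v 20 - p 14 * v 21 - p 8 * v 22 - p 10 * v 23,
      p 23 * v 9 + p 6 * v 11 - p 17 * v 12 + (p 27 - p 29) * v 13 - p 9 * v 15 - p 15 * v 16
       + p 22 * v 17 + p 18 * v 20 + p 24 * v 21 - p 7 * v 22 - p 8 * v 23,
      p 19 * v 8 + p 23 * v 10 - p 21 * v 12 + (-p 26 - p 27 + 2 * p 28 + p 29) * v 14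
       + p 13 * v 15 + p 22 * v 18 + p 11 * v 19 - p 20 * v 20 + p 12 * v 21 + p 24 * v 22
       - p 14 * v 23,
      p 19 * v 9 - p 23 * v 11 + p 21 * v 13 + p 17 * v 14 + (p 28 - p 29) * v 15 + p 15 * v 18
       + p 22 * v 19 + p 16 * v 20 - p 20 * v 21 + p 18 * v 22 + p 25 * v 23,
      -p 24 * v 8 + p 14 * v 9 - p 8 * v 10 + p 10 * v 11 + p 2 * v 12 - p 4 * v 13 + p 29 * v 16
       + p 13 * v 17 + p 9 * v 18 - p 3 * v 20 + p 5 * v 22,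
      -p 18 * v 8 - p 25 * v 9 + p 7 * v 10 - p 8 * v 11 - p 1 * v 12 + p 2 * v 13 + p 17 * v 16
       + (p 26 + p 27 - p 28 - p 29) * v 17 - p 9 * v 19 + p 3 * v 21 + p 5 * v 23,
      -p 20 * v 8 - p 12 * v 9 - p 25 * v 10 + p 14 * v 11 + p 2 * v 14 + p 4 * v 15
       - p 21 * v 16 + (-p 27 + p 28 + p 29) * v 18 - p 13 * v 19 + p 0 * v 20 + p 3 * v 22,
      -p 16 * v 8 - p 20 * v 9 - p 18 * v 10 - p 24 * v 11 + p 1 * v 14 + p 2 * v 15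
       + p 21 * v 17 - p 17 * v 18 + (p 26 - p 29) * v 19 + p 0 * v 21 - p 3 * v 23,
      -p 22 * v 8 + p 11 * v 9 - p 25 * v 12 + p 14 * v 13 + p 8 * v 14 + p 10 * v 15
       - p 23 * v 16 + p 6 * v 18 + (-p 26 + p 28 + p 29) * v 20 - p 13 * v 21 + p 9 * v 22,
      p 15 * v 8 - p 22 * v 9 - p 18 * v 12 - p 24 * v 13 + p 7 * v 14 + p 8 * v 15 + p 23 * v 17
       + p 6 * v 19 - p 17 * v 20 + (p 27 - p 29) * v 21 - p 9 * v 23,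
      -p 22 * v 10 - p 11 * v 11 + p 20 * v 12 - p 12 * v 13 - p 24 * v 14 + p 14 * v 15
       + p 19 * v 16 + p 23 * v 18 - p 21 * v 20 + (-p 26 - p 27 + 2 * p 28 + p 29) * v 22
       + p 13 * v 23,
      -p 15 * v 10 - p 22 * v 11 - p 16 * v 12 + p 20 * v 13 - p 18 * v 14 - p 25 * v 15
       + p 19 * v 17 - p 23 * v 19 + p 21 * v 21 + p 17 * v 22 + (p 28 - p 29) * v 23]
  map_add' v w := by
    simp only [Matrix.cons_add_cons, Matrix.empty_add_empty, Matrix.vecCons_inj, Pi.add_apply]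
    and_intros <;> first | ring1 | trivial
  map_smul' c v := by
    simp only [Matrix.smul_cons, Matrix.smul_empty, Matrix.vecCons_inj, Pi.smul_apply,
      smul_eq_mul, RingHom.id_apply]
    and_intros <;> first | ring1 | trivial

set_option maxHeartbeats 4000000 in
lemma derivationOf_coordinate (p : Fin 30 → ℝ) (n : Fin 30) :
    derivationOf p (Pi.single (coordinate n).2 1) (coordinate n).1 = p n := by
  fin_cases n <;> simp [derivationOf, coordinate]

set_option maxHeartbeats 4000000 in
lemma isSPDer_derivationOf (p : Fin 30 → ℝ) : IsSPDer (derivationOf p) := by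
  have hNm2 : ∀ v ∈ Nm2, derivationOf p v ∈ Nm2 := fun v hv k hk => by
    have h0 : ∀ k : Fin 24, 8 ≤ (k : ℕ) → v k = 0 := hv
    fin_cases k <;> simp_all [derivationOf]
  refine ⟨fun v hv k hk => ?_, hNm2, fun v w => ?_⟩
  · have h0 : ∀ k : Fin 24, (k : ℕ) < 8 → v k = 0 := hv
    fin_cases k <;> simp_all [derivationOf]
  · ext k
    by_cases hk : (k : ℕ) < 8
    · obtain ⟨l, rfl⟩ : ∃ l : Fin 8, k = l.castLE (by norm_num) := ⟨⟨k, hk⟩, rfl⟩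
      fin_cases l <;> simp [derivationOf, br] <;> ring
    · rw [Pi.add_apply, br_apply_of_le _ _ (not_lt.mp hk), br_apply_of_le _ _ (not_lt.mp hk),
        add_zero]
      exact hNm2 _ (fun _ => br_apply_of_le _ _) k (not_lt.mp hk)

lemma br_swap (v w : Pt) : br v w = -br w v := by
  ext k
  by_cases hk : (k : ℕ) < 8
  · change br v w (Fin.castLE (by norm_num) ⟨k, hk⟩) =
      -br w v (Fin.castLE (by norm_num) ⟨k, hk⟩)
    rw [br_apply_castLE, br_apply_castLE, List.sum_neg, List.map_map]
    congr 1
    refine List.map_congr_left fun t _ => ?_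
    simp only [Function.comp_apply]
    ring
  · simp [br_apply_of_le _ _ (not_lt.mp hk)]

lemma br_add_right (u v w : Pt) : br u (v + w) = br u v + br u w := by
  ext k
  by_cases hk : (k : ℕ) < 8
  · change br u (v + w) (Fin.castLE (by norm_num) ⟨k, hk⟩) =
      br u v (Fin.castLE (by norm_num) ⟨k, hk⟩) + br u w (Fin.castLE (by norm_num) ⟨k, hk⟩)
    rw [br_apply_castLE, br_apply_castLE, br_apply_castLE, ← List.sum_map_add]
    congr 1
    refine List.map_congr_left fun t _ => ?_
    simp only [Pi.add_apply]
    ring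
  · simp [br_apply_of_le _ _ (not_lt.mp hk)]

lemma br_smul_right (c : ℝ) (v w : Pt) : br v (c • w) = c • br v w := by
  ext k
  by_cases hk : (k : ℕ) < 8
  · change br v (c • w) (Fin.castLE (by norm_num) ⟨k, hk⟩) =
      c * br v w (Fin.castLE (by norm_num) ⟨k, hk⟩)
    rw [br_apply_castLE, br_apply_castLE, ← List.sum_map_mul_left]
    congr 1
    refine List.map_congr_left fun t _ => ?_
    simp only [Pi.smul_apply, smul_eq_mul]
    ring
  · simp [br_apply_of_le _ _ (not_lt.mp hk)]

/-- The bracket of `n_{E_II}` as a bilinear map. -/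
def brBilin : Pt →ₗ[ℝ] Pt →ₗ[ℝ] Pt :=
  LinearMap.mk₂ ℝ br
    (fun u v w => by
      rw [br_swap, br_add_right, neg_add, ← br_swap, ← br_swap])
    (fun c v w => by
      rw [br_swap, br_smul_right, ← smul_neg, ← br_swap])
    br_add_right br_smul_right

lemma br_eq_brBilin (v w : Pt) : br v w = brBilin v w := rfl

/-- The strata-preserving derivations as a subspace of `gl(n_{E_II})`. -/
def spDer : Submodule ℝ (Module.End ℝ Pt) where
  carrier := {A | IsSPDer A}
  add_mem' := by
    rintro A B ⟨hA₁, hA₂, hA⟩ ⟨hB₁, hB₂, hB⟩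
    refine ⟨fun v hv => add_mem (hA₁ v hv) (hB₁ v hv),
      fun v hv => add_mem (hA₂ v hv) (hB₂ v hv), fun v w => ?_⟩
    simp only [br_eq_brBilin, LinearMap.add_apply, map_add] at hA hB ⊢
    rw [hA, hB]
    abel
  zero_mem' := ⟨fun _ _ => zero_mem _, fun _ _ => zero_mem _, fun v w => by
    simp [br_eq_brBilin]⟩
  smul_mem' := by
    rintro c A ⟨hA₁, hA₂, hA⟩
    refine ⟨fun v hv => Submodule.smul_mem _ c (hA₁ v hv),
      fun v hv => Submodule.smul_mem _ c (hA₂ v hv), fun v w => ?_⟩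
    simp only [br_eq_brBilin, LinearMap.smul_apply, map_smul] at hA ⊢
    rw [hA, smul_add]

lemma IsSPDer.commutator {A B : Module.End ℝ Pt} (hA : IsSPDer A) (hB : IsSPDer B) :
    IsSPDer (A * B - B * A) := by
  obtain ⟨hA₁, hA₂, hA⟩ := hA
  obtain ⟨hB₁, hB₂, hB⟩ := hB
  refine ⟨fun v hv => sub_mem (hA₁ _ (hB₁ v hv)) (hB₁ _ (hA₁ v hv)),
    fun v hv => sub_mem (hA₂ _ (hB₂ v hv)) (hB₂ _ (hA₂ v hv)), fun v w => ?_⟩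
  simp only [br_eq_brBilin, LinearMap.sub_apply, Module.End.mul_apply, map_sub] at hA hB ⊢
  simp only [hA, hB, map_add]
  abel

/-- The entries of an endomorphism at the positions `coordinate n`. -/
def coordinateMap : Module.End ℝ Pt →ₗ[ℝ] (Fin 30 → ℝ) where
  toFun A n := A (Pi.single (coordinate n).2 1) (coordinate n).1
  map_add' _ _ := rfl
  map_smul' _ _ := rfl

lemma bijective_coordinateMap_domRestrict :
    Function.Bijective (coordinateMap.domRestrict spDer) := by
  constructor
  · refine (injective_iff_map_eq_zero _).mpr ?_
    rintro ⟨A, hA⟩ h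
    exact Subtype.ext (IsSPDer.eq_zero hA (congrFun h))
  · exact fun p => ⟨⟨derivationOf p, isSPDer_derivationOf p⟩,
      funext (derivationOf_coordinate p)⟩

/-- The strata-preserving derivations of the 2-step nilpotent Lie algebra `n_{E_II}`
form a Lie subalgebra of `gl(n_{E_II})` of real dimension 30. -/
theorem nEII_strata_preserving_derivations_dim_30 :
    ∃ W : Submodule ℝ (Module.End ℝ Pt),
      -- the strata-preserving derivations form a linear subspace of gl(n) …
      (W : Set (Module.End ℝ Pt)) = {A : Module.End ℝ Pt | IsSPDer A} ∧
      -- … closed under the commutator bracket, i.e. a Lie subalgebra of gl(n), …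
      (∀ A ∈ W, ∀ B ∈ W, A * B - B * A ∈ W) ∧
      -- … of real dimension 30.
      Module.finrank ℝ ↥W = 30 := by
  refine ⟨spDer, rfl, fun A hA B hB => IsSPDer.commutator hA hB, ?_⟩
  rw [(LinearEquiv.ofBijective _ bijective_coordinateMap_domRestrict).finrank_eq]
  simp
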